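/- Let (A_i)_{i∈ℕ} be a sequence of arcs in K converging in the Hausdorff metric to a set B, and suppose there is M > 0 such that for each i there is m_i ∈ ℕ with π_{m_i} restricted to A_i injective and s^{m_i} · diam(π_{m_i}(A_i)) ≤ M (i.e., ℓ(A_i) ≤ M for all i). Then B is an arc in K (possibly degenerate, i.e., a single point), and there is m ∈ ℕ with π_m restricted to B injective and s^m · diam(π_m(B)) ≤ M (i.e., ℓ(B) ≤ M). -/

import Mathlib

open Set Filter Topology Function

noncomputable section

/-- The tent map with slope `s`. -/
def tent (s : ℝ) (x : ℝ) : ℝ := min (s * x) (s * (1 - x))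

/-- The ω-limit set of `c` under iteration of `f`. -/
def omegaSet (f : ℝ → ℝ) (c : ℝ) : Set ℝ :=
  {y | ∃ φ : ℕ → ℕ, StrictMono φ ∧ Tendsto (fun k => f^[φ k] c) atTop (𝓝 y)}

/-- The inverse limit space `K = lim←([0,1], T)`, as a subset of `ℕ → ℝ`. -/
def invLim (s : ℝ) : Set (ℕ → ℝ) :=
  {x | (∀ n, x n ∈ Icc (0 : ℝ) 1) ∧ ∀ n, x n = tent s (x (n + 1))}

/-- The `n`-th coordinate projection `π_n : K → [0,1]`. -/
def proj (s : ℝ) (n : ℕ) (x : invLim s) : ℝ := (x : ℕ → ℝ) n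

/-- The inverse shift homeomorphism `σ̂⁻¹(x₀,x₁,…) = (x₁,x₂,…)` as a map `K → K`. -/
def shiftInvFun (s : ℝ) (x : invLim s) : invLim s :=
  ⟨fun n => (x : ℕ → ℝ) (n + 1), fun n => x.2.1 (n + 1), fun n => x.2.2 (n + 1)⟩

/-- The shift homeomorphism `σ̂(x₀,x₁,…) = (T x₀, x₀, x₁, …)` as a map `K → K`. -/
def shiftFwdFun (s : ℝ) (hs1 : Real.sqrt 2 < s) (hs2 : s < 2) (x : invLim s) : invLim s := by
  refine ⟨fun n => Nat.casesOn n (tent s ((x : ℕ → ℝ) 0)) (fun k => (x : ℕ → ℝ) k), ?_, ?_⟩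
  · intro n
    cases n with
    | zero =>
      have hx0 := x.2.1 0
      have hs0 : 0 ≤ s := le_of_lt (lt_of_le_of_lt (Real.sqrt_nonneg 2) hs1)
      constructor
      · exact le_min (mul_nonneg hs0 hx0.1) (mul_nonneg hs0 (by linarith [hx0.2]))
      · rcases le_total ((x : ℕ → ℝ) 0) (1 / 2) with hc | hc
        · exact le_trans (min_le_left _ _) (by nlinarith [hx0.1, hx0.2])
        · exact le_trans (min_le_right _ _) (by nlinarith [hx0.1, hx0.2])
    | succ k => exact x.2.1 k
  · intro n
    cases n with
    | zero => rfl
    | succ k => exact x.2.2 k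

/-- The integer power `σ̂^b` of the shift homeomorphism : for `b ≥ 0` it is the `b`-th iterate
of `σ̂`, and for `b < 0` the `|b|`-th iterate of `σ̂⁻¹`. -/
def shiftZ (s : ℝ) (hs1 : Real.sqrt 2 < s) (hs2 : s < 2) (b : ℤ) : invLim s → invLim s :=
  if 0 ≤ b then (shiftFwdFun s hs1 hs2)^[b.toNat] else (shiftInvFun s)^[(-b).toNat]

/-- The set `F` of folding points of `K`. -/
def foldingPts (s : ℝ) : Set (invLim s) :=
  {x | ∀ n, proj s n x ∈ omegaSet (tent s) (1 / 2)}

/-- The set `E_p` of `p`-points of `K`. -/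
def pPoints (s : ℝ) (p : ℕ) : Set (invLim s) :=
  {x | ∃ n, p < n ∧ proj s n x = 1 / 2}

/-- `A` is an arc with endpoints `a` and `b`. -/
def IsArcWith {X : Type*} [TopologicalSpace X] (A : Set X) (a b : X) : Prop :=
  ∃ f : unitInterval → X, Topology.IsEmbedding f ∧ range f = A ∧ f 0 = a ∧ f 1 = b

/-- `A` is an arc (a homeomorphic copy of `[0,1]`). -/
def IsArc {X : Type*} [TopologicalSpace X] (A : Set X) : Prop :=
  ∃ a b, IsArcWith A a b

/-- `A` is an arc with endpoints `a`, `b`, possibly degenerate (a single point when `a = b`). -/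
def IsArcBtw {X : Type*} [TopologicalSpace X] (A : Set X) (a b : X) : Prop :=
  IsArcWith A a b ∨ (a = b ∧ A = {a})

/-- `A` is an arc, possibly degenerate (i.e. a single point). -/
def IsArcOrPoint {X : Type*} [TopologicalSpace X] (A : Set X) : Prop :=
  IsArc A ∨ ∃ x, A = {x}

/-- The composant of a point `x`: the union of all proper subcontinua containing `x`. -/
def composant {X : Type*} [TopologicalSpace X] (x : X) : Set X :=
  {y | ∃ A : Set X, IsCompact A ∧ IsConnected A ∧ A ≠ univ ∧ x ∈ A ∧ y ∈ A}

/-- `g` preserves the order along composants: for every composant `C` and every continuous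
bijection `φ` from `ℝ` (respectively from `[0,∞)`) onto `C`, the map `φ⁻¹ ∘ g ∘ φ` is strictly
increasing. -/
def PreservesCompOrder {X : Type*} [TopologicalSpace X] (g : X → X) : Prop :=
  ∀ x : X,
    (∀ φ : ℝ → X, Continuous φ → Injective φ → range φ = composant x →
      ∀ t t' u u' : ℝ, g (φ t) = φ u → g (φ t') = φ u' → t < t' → u < u') ∧
    (∀ φ : {r : ℝ // (0 : ℝ) ≤ r} → X, Continuous φ → Injective φ → range φ = composant x →
      ∀ t t' u u', g (φ t) = φ u → g (φ t') = φ u' → t < t' → u < u')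

/-- Two self-maps of `X` are isotopic if there is a continuous `H : X × [0,1] → X` joining them
through homeomorphisms. -/
def Isotopic {X : Type*} [TopologicalSpace X] (f g : X → X) : Prop :=
  ∃ H : X × unitInterval → X, Continuous H ∧ (∀ x, H (x, 0) = f x) ∧ (∀ x, H (x, 1) = g x) ∧
    ∀ t : unitInterval, IsHomeomorph fun x => H (x, t)

/-- The topological limsup of a sequence of subsets. -/
def setLimsup {X : Type*} [TopologicalSpace X] (D : ℕ → Set X) : Set X :=
  {y | ∃ φ : ℕ → ℕ, StrictMono φ ∧ ∃ z : ℕ → X, (∀ k, z k ∈ D (φ k)) ∧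
    Tendsto z atTop (𝓝 y)}

/-- The point `0̄ = (0,0,0,…)` of `K` (an endpoint of `K`). -/
def zeroPt (s : ℝ) (hs1 : Real.sqrt 2 < s) : invLim s := by
  refine ⟨fun _ => 0, fun n => ⟨le_refl 0, zero_le_one⟩, fun n => ?_⟩
  have hs0 : 0 ≤ s := le_of_lt (lt_of_le_of_lt (Real.sqrt_nonneg 2) hs1)
  simp [tent]
  exact hs0

lemma aux_dist {X : Type*} [MetricSpace X] (A : ℕ → Set X) (hAc : ∀ i, IsCompact (A i))
    (hAne : ∀ i, (A i).Nonempty) (B : Set X) (hBc : IsCompact B) (hBne : B.Nonempty)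
    (h : Tendsto (fun i => Metric.hausdorffDist (A i) B) atTop (𝓝 0)) :
    (∀ U : Set X, IsOpen U → B ⊆ U → ∀ᶠ i in atTop, A i ⊆ U) ∧
    (∀ V : Set X, IsOpen V → (B ∩ V).Nonempty → ∀ᶠ i in atTop, (A i ∩ V).Nonempty) := by
  have hfin : ∀ i, Metric.hausdorffEDist (A i) B ≠ ⊤ := fun i =>
    Metric.hausdorffEDist_ne_top_of_nonempty_of_bounded (hAne i) hBne
      (hAc i).isBounded hBc.isBounded
  constructor
  · intro U hU hBU
    obtain ⟨δ, hδ, hsub⟩ := hBc.exists_thickening_subset_open hU hBU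
    filter_upwards [h.eventually (gt_mem_nhds hδ)] with i hi x hx
    obtain ⟨y, hy, hxy⟩ := Metric.exists_dist_lt_of_hausdorffDist_lt hx hi (hfin i)
    exact hsub (Metric.mem_thickening_iff.2 ⟨y, hy, hxy⟩)
  · rintro V hV ⟨b, hb, hbV⟩
    obtain ⟨δ, hδ, hsub⟩ := Metric.isOpen_iff.1 hV b hbV
    filter_upwards [h.eventually (gt_mem_nhds hδ)] with i hi
    obtain ⟨y, hy, hxy⟩ := Metric.exists_dist_lt_of_hausdorffDist_lt' hb hi (hfin i)
    exact ⟨y, hy, hsub hxy⟩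

lemma aux_preconn {X : Type*} [TopologicalSpace X] [T2Space X] (A : ℕ → Set X)
    (hA : ∀ i, IsPreconnected (A i)) (B : Set X) (hBc : IsCompact B)
    (h1 : ∀ U : Set X, IsOpen U → B ⊆ U → ∀ᶠ i in atTop, A i ⊆ U)
    (h2 : ∀ V : Set X, IsOpen V → (B ∩ V).Nonempty → ∀ᶠ i in atTop, (A i ∩ V).Nonempty) :
    IsPreconnected B := by
  rw [isPreconnected_closed_iff]
  intro t t' ht ht' hsub hBt hBt'
  by_contra hne
  rw [Set.not_nonempty_iff_eq_empty] at hne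
  have hd : Disjoint (B ∩ t) (B ∩ t') := by
    rw [Set.disjoint_iff]
    rintro x ⟨⟨hx, hxt⟩, _, hxt'⟩
    have : x ∈ B ∩ (t ∩ t') := ⟨hx, hxt, hxt'⟩
    rwa [hne] at this
  obtain ⟨U, V, hU, hV, hBU, hBV, hUV⟩ :=
    SeparatedNhds.of_isCompact_isCompact (hBc.inter_right ht) (hBc.inter_right ht') hd
  have e1 := h1 (U ∪ V) (hU.union hV) (fun x hx => (hsub hx).imp (fun h => hBU ⟨hx, h⟩)
    (fun h => hBV ⟨hx, h⟩))
  have e2 := h2 U hU (by obtain ⟨x, hx⟩ := hBt; exact ⟨x, hx.1, hBU hx⟩)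
  have e3 := h2 V hV (by obtain ⟨x, hx⟩ := hBt'; exact ⟨x, hx.1, hBV hx⟩)
  obtain ⟨i, hi1, hi2, hi3⟩ := (e1.and (e2.and e3)).exists
  obtain ⟨x, hx, hxU, hxV⟩ := hA i U V hU hV hi1 hi2 hi3
  exact Set.disjoint_left.1 hUV hxU hxV

lemma tent_cont (s : ℝ) : Continuous (tent s) := by unfold tent; fun_prop

lemma proj_cont (s : ℝ) (n : ℕ) : Continuous (proj s n) :=
  (continuous_apply n).comp continuous_subtype_val

lemma proj_iter (s : ℝ) (x : invLim s) (n k : ℕ) :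
    (tent s)^[k] (proj s (n + k) x) = proj s n x := by
  induction k with
  | zero => rfl
  | succ k ih =>
    rw [Function.iterate_succ_apply]
    have : proj s (n + k) x = tent s (proj s (n + k + 1) x) := x.2.2 (n + k)
    rw [← add_assoc, ← this, ih]

lemma tent_lip (s : ℝ) (hs : 0 < s) (a b : ℝ) : |tent s a - tent s b| ≤ s * |a - b| := by
  have := abs_min_sub_min_le_max (s * a) (s * (1 - a)) (s * b) (s * (1 - b))
  refine this.trans (max_le ?_ ?_)
  · rw [← mul_sub, abs_mul, abs_of_pos hs]
  · rw [← mul_sub, abs_mul, abs_of_pos hs, abs_sub_comm a b]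
    apply le_of_eq; congr 2; ring

lemma tent_left (s : ℝ) (hs : 0 < s) {a : ℝ} (h : a ≤ 1 / 2) : tent s a = s * a :=
  min_eq_left (mul_le_mul_of_nonneg_left (by linarith) hs.le)

lemma tent_right (s : ℝ) (hs : 0 < s) {a : ℝ} (h : 1 / 2 ≤ a) : tent s a = s * (1 - a) :=
  min_eq_right (mul_le_mul_of_nonneg_left (by linarith) hs.le)

lemma tent_exp (s : ℝ) (hs : 0 < s) (I : Set ℝ) (hI : I.OrdConnected) (hinj : InjOn (tent s) I)
    {a b : ℝ} (ha : a ∈ I) (hb : b ∈ I) (hab : a ≤ b) :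
    |tent s a - tent s b| = s * |a - b| := by
  rcases le_total b (1 / 2) with h | h
  · rw [tent_left s hs h, tent_left s hs (hab.trans h), ← mul_sub, abs_mul, abs_of_pos hs]
  rcases le_total (1 / 2) a with h' | h'
  · rw [tent_right s hs h', tent_right s hs h, ← mul_sub, abs_mul, abs_of_pos hs,
      abs_sub_comm a b]
    congr 2; ring
  -- the interval straddles the turning point
  set e := min (1 / 2 - a) (b - 1 / 2) with he
  have he0 : 0 ≤ e := le_min (by linarith) (by linarith)
  have he1 : e ≤ 1 / 2 - a := min_le_left _ _
  have he2 : e ≤ b - 1 / 2 := min_le_right _ _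
  have m1 : 1 / 2 - e ∈ I := hI.out ha hb ⟨by linarith, by linarith⟩
  have m2 : 1 / 2 + e ∈ I := hI.out ha hb ⟨by linarith, by linarith⟩
  have := hinj m1 m2 (by
    rw [tent_left s hs (by linarith), tent_right s hs (by linarith)]; ring)
  have e0 : e = 0 := by linarith
  rw [e0] at he
  rcases min_choice (1 / 2 - a) (b - 1 / 2) with h3 | h3
  · have : a = 1 / 2 := by linarith
    rw [tent_right s hs h, tent_right s hs this.ge, ← mul_sub, abs_mul, abs_of_pos hs,
      abs_sub_comm a b]
    congr 2; ring
  · have : b = 1 / 2 := by linarith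
    rw [tent_left s hs h', tent_left s hs this.le, ← mul_sub, abs_mul, abs_of_pos hs]

lemma inj_up (s : ℝ) (A : Set (invLim s)) (m : ℕ) (h : InjOn (proj s m) A) (k : ℕ) :
    InjOn (proj s (m + k)) A := by
  intro x hx y hy hxy
  apply h hx hy
  rw [← proj_iter s x m k, ← proj_iter s y m k, hxy]

lemma proj_step (s : ℝ) (x : invLim s) (n : ℕ) : proj s n x = tent s (proj s (n + 1) x) := x.2.2 n

lemma len_all (s : ℝ) (hs : 0 < s) (A : Set (invLim s)) (hA : IsPreconnected A)
    (hAc : IsCompact A) (M : ℝ)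
    (m : ℕ) (hinj : InjOn (proj s m) A) (hM : s ^ m * Metric.diam (proj s m '' A) ≤ M)
    (n : ℕ) (x y : invLim s) (hx : x ∈ A) (hy : y ∈ A) :
    s ^ n * |proj s n x - proj s n y| ≤ M := by
  have base : s ^ m * |proj s m x - proj s m y| ≤ M := by
    refine le_trans (mul_le_mul_of_nonneg_left ?_ (pow_pos hs m).le) hM
    exact Metric.dist_le_diam_of_mem (hAc.image (proj_cont s m)).isBounded
      (mem_image_of_mem _ hx) (mem_image_of_mem _ hy)
  rcases le_total m n with h | h
  · obtain ⟨k, rfl⟩ := Nat.exists_eq_add_of_le h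
    clear h
    induction k with
    | zero => exact base
    | succ k ih =>
      have hI : (proj s (m + k + 1) '' A).OrdConnected :=
        (hA.image _ (proj_cont s _).continuousOn).ordConnected
      have hin : InjOn (tent s) (proj s (m + k + 1) '' A) := by
        rintro _ ⟨u, hu, rfl⟩ _ ⟨v, hv, rfl⟩ huv
        rw [← proj_step, ← proj_step] at huv
        rw [inj_up s A m hinj k hu hv huv]
      have key : |proj s (m + k) x - proj s (m + k) y| =
          s * |proj s (m + k + 1) x - proj s (m + k + 1) y| := by
        rw [proj_step s x, proj_step s y]
        rcases le_total (proj s (m + k + 1) x) (proj s (m + k + 1) y) with h | h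
        · exact tent_exp s hs _ hI hin (mem_image_of_mem _ hx) (mem_image_of_mem _ hy) h
        · rw [abs_sub_comm, abs_sub_comm (proj s (m + k + 1) x)]
          exact tent_exp s hs _ hI hin (mem_image_of_mem _ hy) (mem_image_of_mem _ hx) h
      rw [key, ← mul_assoc, ← pow_succ] at ih
      exact ih
  · induction h using Nat.decreasingInduction with
    | self => exact base
    | of_succ k hk ih =>
      refine le_trans ?_ ih
      rw [pow_succ, mul_assoc, proj_step s x, proj_step s y]
      exact mul_le_mul_of_nonneg_left (tent_lip s hs _ _) (pow_pos hs k).le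

lemma crit_nonrecurrent (s : ℝ) (hnr : (1 : ℝ) / 2 ∉ omegaSet (tent s) (1 / 2)) :
    ∃ δ > 0, ∃ N : ℕ, ∀ k ≥ N, δ ≤ |(tent s)^[k] (1 / 2) - 1 / 2| := by
  by_contra! hc
  apply hnr
  have hf : ∀ n : ℕ, ∃ᶠ k in atTop, |(tent s)^[k] (1 / 2) - 1 / 2| < 1 / ((n : ℝ) + 1) := by
    intro n
    rw [frequently_atTop]
    intro N
    exact hc _ (by positivity) N
  obtain ⟨φ, hφ, hp⟩ := extraction_forall_of_frequently hf
  refine ⟨φ, hφ, ?_⟩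
  rw [tendsto_iff_dist_tendsto_zero]
  exact squeeze_zero (fun _ => dist_nonneg) (fun n => (hp n).le)
    tendsto_one_div_add_atTop_nhds_zero_nat

lemma tent_inj_side (s : ℝ) (hs : 0 < s) (I : Set ℝ) (hI : I.OrdConnected) (h : (1 : ℝ) / 2 ∉ I) :
    InjOn (tent s) I := by
  intro a ha b hb hab
  rcases le_total a (1 / 2) with h1 | h1 <;> rcases le_total b (1 / 2) with h2 | h2
  · rw [tent_left s hs h1, tent_left s hs h2] at hab
    exact mul_left_cancel₀ hs.ne' hab
  · exact absurd (hI.out ha hb ⟨h1, h2⟩) h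
  · exact absurd (hI.out hb ha ⟨h2, h1⟩) h
  · rw [tent_right s hs h1, tent_right s hs h2] at hab
    linarith [mul_left_cancel₀ hs.ne' hab]

lemma arc_of_inj {X : Type*} [TopologicalSpace X] (B : Set X) (hBc : IsCompact B)
    (hB : IsPreconnected B) (hne : B.Nonempty) (g : X → ℝ) (hg : Continuous g)
    (hinj : InjOn g B) : IsArcOrPoint B := by
  have himc := hBc.image hg
  have hconn : IsConnected (g '' B) := ⟨hne.image g, hB.image g hg.continuousOn⟩
  have hI := eq_Icc_of_connected_compact hconn himc
  generalize sInf (g '' B) = a at hI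
  generalize sSup (g '' B) = b at hI
  rcases lt_or_ge a b with hab | hab
  · left
    haveI : CompactSpace B := isCompact_iff_compactSpace.1 hBc
    let e0 : B ≃ Icc a b := (Equiv.Set.imageOfInjOn g B hinj).trans (Equiv.setCongr hI)
    have he0 : Continuous e0 :=
      Continuous.subtype_mk (hg.comp continuous_subtype_val) _
    let e : B ≃ₜ Icc a b := he0.homeoOfEquivCompactToT2
    let E : unitInterval ≃ₜ B := (iccHomeoI a b hab).symm.trans e.symm
    refine ⟨_, _, fun t => (E t : X), ?_, ?_, rfl, rfl⟩
    · exact Topology.IsEmbedding.subtypeVal.comp E.isEmbedding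
    · change range (Subtype.val ∘ E) = B
      rw [E.surjective.range_comp, Subtype.range_coe]
  · right
    obtain ⟨x, hx⟩ := hne
    refine ⟨x, Set.eq_singleton_iff_unique_mem.2 ⟨hx, fun y hy => hinj hy hx ?_⟩⟩
    have h1 : g x ∈ Icc a b := hI ▸ mem_image_of_mem g hx
    have h2 : g y ∈ Icc a b := hI ▸ mem_image_of_mem g hy
    linarith [h1.1, h1.2, h2.1, h2.2]

/-- Lemma 5.4: a Hausdorff-metric limit of arcs of `d̄`-length at most `M` is a
(possibly degenerate) arc of `d̄`-length at most `M`. -/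
theorem statement5 (s : ℝ) (hs1 : Real.sqrt 2 < s) (hs2 : s < 2)
    (hnr : (1 : ℝ) / 2 ∉ omegaSet (tent s) (1 / 2))
    (A : ℕ → Set (invLim s)) (hA : ∀ i, IsArc (A i))
    (B : Set (invLim s)) (hBc : IsCompact B) (hBne : B.Nonempty)
    (M : ℝ) (hM : 0 < M)
    (hlen : ∀ i, ∃ m : ℕ, InjOn (proj s m) (A i) ∧
      s ^ m * Metric.diam (proj s m '' A i) ≤ M)
    (hconv : letI : MetricSpace (invLim s) := TopologicalSpace.metrizableSpaceMetric _
      Tendsto (fun i => Metric.hausdorffDist (A i) B) atTop (𝓝 0)) :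
    IsArcOrPoint B ∧
      ∃ m : ℕ, InjOn (proj s m) B ∧ s ^ m * Metric.diam (proj s m '' B) ≤ M := by
  have hs : 0 < s := lt_of_le_of_lt (Real.sqrt_nonneg 2) hs1
  have hs' : 1 < s := lt_of_le_of_lt (by rw [Real.one_le_sqrt]; norm_num) hs1
  have hAc : ∀ i, IsCompact (A i) := by
    intro i
    obtain ⟨a, b, f, hf, h, _⟩ := hA i
    rw [← h]; exact isCompact_range hf.continuous
  have hAne : ∀ i, (A i).Nonempty := by
    intro i
    obtain ⟨a, b, f, hf, h, _⟩ := hA i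
    rw [← h]; exact range_nonempty f
  have hAp : ∀ i, IsPreconnected (A i) := by
    intro i
    obtain ⟨a, b, f, hf, h, _⟩ := hA i
    rw [← h]; exact isPreconnected_range hf.continuous
  obtain ⟨h1, h2⟩ := @aux_dist _ (TopologicalSpace.metrizableSpaceMetric (invLim s)) A hAc hAne B
    hBc hBne hconv
  have hBp := aux_preconn A hAp B hBc h1 h2
  have hBlen : ∀ n, ∀ x ∈ B, ∀ y ∈ B, s ^ n * |proj s n x - proj s n y| ≤ M := by
    intro n x hx y hy
    have key : |proj s n x - proj s n y| ≤ M / s ^ n := by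
      apply le_of_forall_pos_le_add
      intro ε hε
      have ev : ∀ z ∈ B, ∀ᶠ i in atTop,
          (A i ∩ {w | |proj s n w - proj s n z| < ε / 2}).Nonempty := by
        intro z hz
        apply h2
        · have := proj_cont s n
          exact isOpen_lt (by fun_prop) continuous_const
        · exact ⟨z, hz, by simpa using hε⟩
      obtain ⟨i, ⟨u, hu, hux⟩, ⟨v, hv, hvy⟩⟩ := ((ev x hx).and (ev y hy)).exists
      obtain ⟨m, hm1, hm2⟩ := hlen i
      have := len_all s hs (A i) (hAp i) (hAc i) M m hm1 hm2 n u v hu hv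
      rw [← le_div_iff₀' (pow_pos hs n)] at this
      simp only [mem_ofPred_eq] at hux hvy
      rw [abs_lt] at hux hvy
      rw [abs_le] at this ⊢
      constructor <;> linarith [hux.1, hux.2, hvy.1, hvy.2, this.1, this.2]
    rwa [← le_div_iff₀' (pow_pos hs n)]
  obtain ⟨δ, hδ, K, hK⟩ := crit_nonrecurrent s hnr
  obtain ⟨N, hN⟩ : ∃ N : ℕ, ∀ n ≥ N, M < s ^ n * δ := by
    have := (tendsto_pow_atTop_atTop_of_one_lt hs').eventually_gt_atTop (M / δ)
    obtain ⟨N, hN⟩ := eventually_atTop.1 this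
    exact ⟨N, fun n hn => (div_lt_iff₀ hδ).1 (hN n hn)⟩
  have hno : ∀ n ≥ N, ∀ k ≥ K, ∀ x ∈ B, ∀ y ∈ B, proj s n x = 1 / 2 →
      proj s (n + k) y ≠ 1 / 2 := by
    intro n hn k hk x hx y hy hxn hyn
    have e1 := hK k hk
    have e2 := proj_iter s y n k
    rw [hyn] at e2
    rw [e2, ← hxn] at e1
    have e3 := hBlen n y hy x hx
    have e4 := hN n hn
    have := mul_le_mul_of_nonneg_left e1 (pow_pos hs n).le
    linarith
  obtain ⟨m, hm⟩ : ∃ m : ℕ, ∀ n ≥ m, (1 : ℝ) / 2 ∉ proj s n '' B := by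
    by_cases hex : ∃ n ≥ N, (1 : ℝ) / 2 ∈ proj s n '' B
    · obtain ⟨n, hn, x, hx, hxn⟩ := hex
      refine ⟨n + K, fun p hp => ?_⟩
      rintro ⟨y, hy, hyp⟩
      obtain ⟨k, rfl⟩ := Nat.exists_eq_add_of_le (le_trans (Nat.le_add_right n K) hp)
      exact hno n hn k (by omega) x hx y hy hxn hyp
    · push Not at hex
      exact ⟨N, hex⟩
  have hinj : InjOn (proj s m) B := by
    intro x hx y hy hxy
    have hup : ∀ k, proj s (m + k) x = proj s (m + k) y := by
      intro k
      induction k with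
      | zero => exact hxy
      | succ k ih =>
        rw [proj_step s x, proj_step s y] at ih
        exact tent_inj_side s hs _
          (hBp.image _ (proj_cont s (m + k + 1)).continuousOn).ordConnected
          (hm _ (by omega)) (mem_image_of_mem _ hx) (mem_image_of_mem _ hy) ih
    apply Subtype.ext
    funext n
    change proj s n x = proj s n y
    rw [← proj_iter s x n m, ← proj_iter s y n m, add_comm, hup]
  refine ⟨arc_of_inj B hBc hBp hBne _ (proj_cont s m) hinj, m, hinj, ?_⟩
  rw [← le_div_iff₀' (pow_pos hs m)]
  apply Metric.diam_le_of_forall_dist_le (div_nonneg hM.le (pow_pos hs m).le)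
  rintro _ ⟨x, hx, rfl⟩ _ ⟨y, hy, rfl⟩
  rw [le_div_iff₀' (pow_pos hs m)]
  exact hBlen m x hx y hy
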